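/- Assume z, w ∈ T, w ≠ 0, ⟨w, z⟩ > ε, and w = w_{𝒢(z)}. Then it is impossible to simultaneously have λ₁ ≤ r < ∞, zₙ − λ₁wₙ < 0, λ₀ ≤ r, and n' = n + 1 (i.e., zᵢ − λ₀wᵢ ≥ 0 for all i). -/

import Mathlib

open Finset

/-- The monotone nonnegative cone `T = {x : x₁ ≥ x₂ ≥ ⋯ ≥ xₙ ≥ 0}`. -/
def coneT (n : ℕ) : Set (Fin n → ℝ) := {x | Antitone x ∧ ∀ i, 0 ≤ x i}

/-- Euclidean inner product on `Fin n → ℝ`. -/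
def dot {n : ℕ} (x y : Fin n → ℝ) : ℝ := ∑ i, x i * y i

/-- `x` is the Euclidean projection of `z` onto `C` (minimizer of the distance to `z` over `C`). -/
def IsProjOn {n : ℕ} (C : Set (Fin n → ℝ)) (z x : Fin n → ℝ) : Prop :=
  x ∈ C ∧ ∀ y ∈ C, ∑ i, (x i - z i) ^ 2 ≤ ∑ i, (y i - z i) ^ 2

/-- The ordered weighted ℓ₁ (OWL) norm `Ω_w(x) = ∑ᵢ wᵢ |x|_[i]`,
where `|x|_[i]` is the i-th largest entry of `(|x₁|, …, |xₙ|)`. -/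
noncomputable def owl {n : ℕ} (w x : Fin n → ℝ) : ℝ :=
  ∑ i : Fin n, w i * |x ((Tuple.sort fun j => |x j|) i.rev)|

/-- The closed OWL norm ball `B(w, ε)`. -/
def owlBall {n : ℕ} (w : Fin n → ℝ) (ε : ℝ) : Set (Fin n → ℝ) := {x | owl w x ≤ ε}

/-- The half-space `L(w, ε) = {x : ⟨w, x⟩ ≤ ε}`. -/
def halfSpace {n : ℕ} (w : Fin n → ℝ) (ε : ℝ) : Set (Fin n → ℝ) := {x | dot w x ≤ ε}

/-- The hyperplane `H(w, ε) = {x : ⟨w, x⟩ = ε}`. -/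
def hyperplane {n : ℕ} (w : Fin n → ℝ) (ε : ℝ) : Set (Fin n → ℝ) := {x | dot w x = ε}

/-- `P ∈ 𝒫ₙ`: a partition of `{0, …, n-1}` all of whose blocks are intervals. -/
def IsIntervalPartition {n : ℕ} (P : Finset (Finset (Fin n))) : Prop :=
  (∀ G ∈ P, G.Nonempty) ∧
  (∀ i : Fin n, ∃! G, G ∈ P ∧ i ∈ G) ∧
  (∀ G ∈ P, ∀ i ∈ G, ∀ k ∈ G, ∀ j : Fin n, i ≤ j → j ≤ k → j ∈ G)

/-- `P ≼ Q`: every block of `P` is contained in some block of `Q`. -/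
def Refines {n : ℕ} (P Q : Finset (Finset (Fin n))) : Prop :=
  ∀ G ∈ P, ∃ H ∈ Q, G ⊆ H

/-- `i` and `j` lie in a common block of `P`. -/
def SameBlock {n : ℕ} (P : Finset (Finset (Fin n))) (i j : Fin n) : Prop :=
  ∃ G ∈ P, i ∈ G ∧ j ∈ G

/-- `P = 𝒢(z)`: the partition of indices into maximal intervals of nondecreasing
components of `z`; consecutive indices lie in the same block iff `zᵢ ≤ zᵢ₊₁`. -/
def IsGroupPartition {n : ℕ} (z : Fin n → ℝ) (P : Finset (Finset (Fin n))) : Prop :=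
  IsIntervalPartition P ∧
  ∀ (i : Fin n) (h : i.val + 1 < n),
    (SameBlock P i ⟨i.val + 1, h⟩ ↔ z i ≤ z ⟨i.val + 1, h⟩)

/-- `v = z_P`: the vector obtained from `z` by averaging over the blocks of `P`. -/
def IsAvg {n : ℕ} (P : Finset (Finset (Fin n))) (z v : Fin n → ℝ) : Prop :=
  ∀ G ∈ P, ∀ i ∈ G, v i = (∑ k ∈ G, z k) / (G.card : ℝ)

/-- `(lam, v)` is a KKT pair for `x` in the reduced problem
`min ½‖x − z‖² s.t. ⟨w, x⟩ = ε, x ∈ T`. -/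
def IsKKT {n : ℕ} (z w : Fin n → ℝ) (ε : ℝ) (x : Fin n → ℝ) (lam : ℝ)
    (v : Fin n → ℝ) : Prop :=
  0 < lam ∧ (∀ i, 0 ≤ v i) ∧ x ∈ coneT n ∧
  (∀ (i : Fin n) (h : i.val + 1 < n), v i * (x i - x ⟨i.val + 1, h⟩) = 0) ∧
  (∀ h : 0 < n, v ⟨n - 1, Nat.sub_lt h one_pos⟩ * x ⟨n - 1, Nat.sub_lt h one_pos⟩ = 0) ∧
  (∀ i : Fin n, x i = z i - lam * w i + v i -
    (if _ : i.val = 0 then 0 else v ⟨i.val - 1, lt_of_le_of_lt (Nat.sub_le _ _) i.isLt⟩)) ∧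
  dot w x = ε

/-- The last index `n - 1` of `Fin n`. -/
def lastIdx {n : ℕ} (hn : 0 < n) : Fin n := ⟨n - 1, Nat.sub_lt hn one_pos⟩

/-- `r = min {(zᵢ − zᵢ₊₁)/(wᵢ − wᵢ₊₁)}` in the extended reals, with `0/0 = ∞`, `a/0 = ∞`. -/
noncomputable def rmin {n : ℕ} (z w : Fin n → ℝ) : EReal :=
  ⨅ i : Fin n,
    if h : i.val + 1 < n then
      (if w i - w ⟨i.val + 1, h⟩ = 0 then (⊤ : EReal)
       else (((z i - z ⟨i.val + 1, h⟩) / (w i - w ⟨i.val + 1, h⟩) : ℝ) : EReal))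
    else ⊤

/-- `λ₁ = (⟨z, w⟩ − ε)/‖w‖²`. -/
noncomputable def lam1 {n : ℕ} (z w : Fin n → ℝ) (ε : ℝ) : ℝ :=
  (dot z w - ε) / dot w w

/-- `λ₀ = ((Σ_{i : zᵢ > zₙ} zᵢwᵢ) − ε)/(Σ_{i : zᵢ > zₙ} wᵢ²)`. -/
noncomputable def lam0 {n : ℕ} (hn : 0 < n) (z w : Fin n → ℝ) (ε : ℝ) : ℝ :=
  ((∑ i ∈ Finset.univ.filter (fun i => z (lastIdx hn) < z i), z i * w i) - ε) /
    (∑ i ∈ Finset.univ.filter (fun i => z (lastIdx hn) < z i), w i ^ 2)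

/-- `n' = min({k : z_k − λ₀ w_k < 0} ∪ {n+1})`, with 1-based indexing `k = i + 1`. -/
noncomputable def nprime {n : ℕ} (z w : Fin n → ℝ) (l0 : ℝ) : ℕ :=
  sInf {k | k = n + 1 ∨ ∃ i : Fin n, i.val + 1 = k ∧ z i - l0 * w i < 0}

/-- Componentwise sign, with the convention `sgn 0 = 1`. -/
noncomputable def sgn (t : ℝ) : ℝ := if t < 0 then -1 else 1

/-- The simplex `Δ(κ, n) = {x : x ≥ 0, Σ xᵢ = κ}`. -/
def simplexSet (κ : ℝ) (n : ℕ) : Set (Fin n → ℝ) :=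
  {x | (∀ i, 0 ≤ x i) ∧ ∑ i, x i = κ}


/-- A vector averaged over the group partition of a monotone `z` is constant on the set of
indices where `z` takes its last value. -/
theorem eq_lastIdx_of_le_lastIdx {n : ℕ} (hn : 0 < n) {z w : Fin n → ℝ} (hz : Antitone z)
    {P : Finset (Finset (Fin n))} (hP : IsGroupPartition z P) (hw : IsAvg P w w)
    (i : Fin n) (hi : z i ≤ z (lastIdx hn)) : w i = w (lastIdx hn) := by
  obtain ⟨i, hin⟩ := i
  induction k : n - 1 - i generalizing i with
  | zero =>
    have : (⟨i, hin⟩ : Fin n) = lastIdx hn := Fin.ext (by simp only [lastIdx]; omega)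
    rw [this]
  | succ k ih =>
    have hlt : i + 1 < n := by omega
    have hnext : z ⟨i + 1, hlt⟩ ≤ z ⟨i, hin⟩ := hz (Fin.mk_le_mk.2 (Nat.le_succ i))
    have hlast : z (lastIdx hn) ≤ z ⟨i + 1, hlt⟩ :=
      hz (Fin.mk_le_mk.2 (by omega))
    obtain ⟨G, hG, h1, h2⟩ := (hP.2 ⟨i, hin⟩ hlt).2 (hi.trans hlast)
    rw [← ih (i + 1) hlt (hnext.trans hi) (by omega), hw G hG _ h1, hw G hG _ h2]

/-- If `rmin z w` is finite then `w` is not constant. -/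
theorem exists_ne_of_rmin_lt_top {n : ℕ} {z w : Fin n → ℝ} (h : rmin z w < ⊤) (c : ℝ) :
    ∃ i, w i ≠ c := by
  by_contra! hc
  simp [rmin, hc] at h

/-- If `nprime z w l = n + 1` then `z - l • w` is nonnegative. -/
theorem nonneg_of_nprime_eq {n : ℕ} {z w : Fin n → ℝ} {l : ℝ} (h : nprime z w l = n + 1)
    (i : Fin n) : 0 ≤ z i - l * w i := by
  by_contra! hi
  have : nprime z w l ≤ i + 1 := Nat.sInf_le (Or.inr ⟨i, rfl, hi⟩)
  omega

/-- Alternative 7. It is impossible to simultaneously have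
`λ₁ ≤ r < ∞`, `zₙ − λ₁wₙ < 0`, `λ₀ ≤ r`, and `n' = n + 1`. -/
theorem alternative_seven_impossible {n : ℕ} (hn : 0 < n) (ε : ℝ) (hε : 0 < ε)
    (w : Fin n → ℝ) (hw_anti : Antitone w) (hw_nonneg : ∀ i, 0 ≤ w i) (hw_ne : w ≠ 0)
    (z : Fin n → ℝ) (hz : z ∈ coneT n) (hw : w ∈ coneT n) (hzw : ε < dot w z)
    (Gz : Finset (Finset (Fin n))) (hGz : IsGroupPartition z Gz) (hwG : IsAvg Gz w w)
    (hr1 : (lam1 z w ε : EReal) ≤ rmin z w) (hr2 : rmin z w < ⊤)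
    (hzn : z (lastIdx hn) - lam1 z w ε * w (lastIdx hn) < 0)
    (hl0r : (lam0 hn z w ε : EReal) ≤ rmin z w)
    (hnp : nprime z w (lam0 hn z w ε) = n + 1) :
    False := by
  have hconst := eq_lastIdx_of_le_lastIdx hn hz.1 hGz hwG
  have hlast := nonneg_of_nprime_eq hnp (lastIdx hn)
  have hc : 0 ≤ z (lastIdx hn) := hz.2 _
  have hb : 0 < w (lastIdx hn) := by
    refine (hw_nonneg _).lt_of_ne fun h => ?_
    rw [← h] at hzn
    linarith
  have hwpos (i : Fin n) : 0 < w i :=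
    hb.trans_le (hw_anti (Fin.mk_le_mk.2 (Nat.le_sub_one_of_lt i.isLt)))
  obtain ⟨i, hi⟩ := exists_ne_of_rmin_lt_top hr2 (w (lastIdx hn))
  have hB : 0 < ∑ i ∈ univ.filter (fun i => z (lastIdx hn) < z i), w i ^ 2 :=
    sum_pos (fun j _ => pow_pos (hwpos j) 2)
      ⟨i, mem_filter.2 ⟨mem_univ _, not_le.1 fun h => hi (hconst i h)⟩⟩
  have hsplit (f : Fin n → ℝ) := sum_filter_add_sum_filter_not univ
    (fun i => z (lastIdx hn) < z i) f
  have htail (j : Fin n) (hj : j ∈ univ.filter (fun i => ¬ z (lastIdx hn) < z i)) :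
      z j = z (lastIdx hn) ∧ w j = w (lastIdx hn) := by
    have hle := not_lt.1 (mem_filter.1 hj).2
    exact ⟨hle.antisymm (hz.1 (Fin.mk_le_mk.2 (Nat.le_sub_one_of_lt j.isLt))), hconst j hle⟩
  have hzw_tail : ∑ i ∈ univ.filter (fun i => ¬ z (lastIdx hn) < z i), z i * w i =
      #(univ.filter (fun i => ¬ z (lastIdx hn) < z i)) * (z (lastIdx hn) * w (lastIdx hn)) := by
    rw [← nsmul_eq_mul, ← sum_const]
    exact sum_congr rfl fun j hj => by rw [(htail j hj).1, (htail j hj).2]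
  have hww_tail : ∑ i ∈ univ.filter (fun i => ¬ z (lastIdx hn) < z i), w i ^ 2 =
      #(univ.filter (fun i => ¬ z (lastIdx hn) < z i)) * w (lastIdx hn) ^ 2 := by
    rw [← nsmul_eq_mul, ← sum_const]
    exact sum_congr rfl fun j hj => by rw [(htail j hj).2]
  have hzw_split := hsplit fun i => z i * w i
  have hww_split := hsplit fun i => w i ^ 2
  rw [hzw_tail] at hzw_split
  rw [hww_tail] at hww_split
  have hdot : dot w w = ∑ i, w i ^ 2 := sum_congr rfl fun j _ => (sq (w j)).symm
  have hm : (0 : ℝ) ≤ #(univ.filter (fun i => ¬ z (lastIdx hn) < z i)) := Nat.cast_nonneg _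
  have hpos : 0 < dot w w := by
    rw [hdot, ← hww_split]
    positivity
  have h1 : lam1 z w ε * dot w w = dot z w - ε := div_mul_cancel₀ _ hpos.ne'
  have h0 := div_mul_cancel₀
    ((∑ i ∈ univ.filter (fun i => z (lastIdx hn) < z i), z i * w i) - ε) hB.ne'
  change lam0 hn z w ε * _ = _ at h0
  rw [hdot, ← hww_split, dot, ← hzw_split] at h1
  have hlt : lam0 hn z w ε < lam1 z w ε := by nlinarith
  have hgap := mul_nonneg hm (mul_nonneg hb.le (neg_nonneg.2 hzn.le))
  nlinarith
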